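/- QR decomposition for quaternion matrices: for every invertible N × N matrix P with entries in the real quaternions ℍ there exist an N × N unitary quaternion matrix U (U⋆U = UU⋆ = 1) and an N × N upper triangular quaternion matrix S (S_{ij} = 0 for i > j) such that P = U S. -/

import Mathlib

open Matrix

/-- The squared Euclidean norm of a quaternion vector. -/
noncomputable def quaternionNormSq {n : ℕ} (w : Fin n → Quaternion ℝ) : ℝ :=
  ∑ i, Quaternion.normSq (w i)

theorem star_dotProduct_self_quaternion {n : ℕ} (w : Fin n → Quaternion ℝ) :
    star w ⬝ᵥ w = (quaternionNormSq w : Quaternion ℝ) := by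
  simp only [dotProduct, Pi.star_apply, Quaternion.star_mul_self, quaternionNormSq]
  exact (map_sum (algebraMap ℝ (Quaternion ℝ)) _ _).symm

theorem quaternionNormSq_nonneg {n : ℕ} (w : Fin n → Quaternion ℝ) : 0 ≤ quaternionNormSq w :=
  Finset.sum_nonneg fun _ _ => Quaternion.normSq_nonneg

theorem quaternionNormSq_eq_zero {n : ℕ} {w : Fin n → Quaternion ℝ} :
    quaternionNormSq w = 0 ↔ w = 0 := by
  simp [quaternionNormSq, Finset.sum_eq_zero_iff_of_nonneg, Quaternion.normSq_nonneg, funext_iff]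

/-- The Householder reflection along `w`; it is the identity when `w = 0`. -/
noncomputable def quaternionHouseholder {n : ℕ} (w : Fin n → Quaternion ℝ) :
    Matrix (Fin n) (Fin n) (Quaternion ℝ) :=
  1 - (2 / quaternionNormSq w) • vecMulVec w (star w)

theorem vecMulVec_star_mul_self_quaternion {n : ℕ} (w : Fin n → Quaternion ℝ) :
    vecMulVec w (star w) * vecMulVec w (star w) =
      quaternionNormSq w • vecMulVec w (star w) := by
  rw [vecMulVec_mul_vecMulVec, star_dotProduct_self_quaternion]
  ext1 i j
  simp only [vecMulVec_apply, Matrix.smul_apply, Pi.smul_apply, smul_eq_mul,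
    Quaternion.coe_mul_eq_smul, mul_smul_comm]

theorem quaternionHouseholder_mem_unitary {n : ℕ} (w : Fin n → Quaternion ℝ) :
    quaternionHouseholder w ∈ unitary (Matrix (Fin n) (Fin n) (Quaternion ℝ)) := by
  have hs : star (quaternionHouseholder w) = quaternionHouseholder w := by
    have hc : star ((2 / quaternionNormSq w) • vecMulVec w (star w)) =
        (2 / quaternionNormSq w) • vecMulVec w (star w) := by
      ext1 i j
      rw [Matrix.star_apply, Matrix.smul_apply, Matrix.smul_apply, Quaternion.star_smul]
      simp [vecMulVec_apply]
    rw [quaternionHouseholder, star_sub, star_one, hc]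
  have hm : quaternionHouseholder w * quaternionHouseholder w = 1 := by
    rcases eq_or_ne (quaternionNormSq w) 0 with h | h
    · simp [quaternionHouseholder, h]
    · simp only [quaternionHouseholder, mul_sub, sub_mul, one_mul, mul_one, smul_mul_smul_comm,
        vecMulVec_star_mul_self_quaternion, smul_smul]
      rw [show 2 / quaternionNormSq w * (2 / quaternionNormSq w) * quaternionNormSq w =
        2 / quaternionNormSq w + 2 / quaternionNormSq w by field_simp; norm_num, add_smul]
      abel
  rw [Unitary.mem_iff, hs]
  exact ⟨hm, hm⟩

theorem quaternionHouseholder_mulVec {n : ℕ} (w v : Fin n → Quaternion ℝ)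
    (h : star w ⬝ᵥ v = ((quaternionNormSq w / 2 : ℝ) : Quaternion ℝ)) :
    quaternionHouseholder w *ᵥ v = v - w := by
  rcases eq_or_ne (quaternionNormSq w) 0 with h0 | h0
  · simp [quaternionHouseholder, quaternionNormSq_eq_zero.1 h0]
  · rw [quaternionHouseholder, sub_mulVec, one_mulVec, smul_mulVec, vecMulVec_mulVec, h]
    ext1 i
    simp only [Pi.sub_apply, Pi.smul_apply, MulOpposite.smul_eq_mul_unop, MulOpposite.unop_op,
      Quaternion.mul_coe_eq_smul, smul_smul]
    rw [show 2 / quaternionNormSq w * (quaternionNormSq w / 2) = 1 by field_simp, one_smul]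

/-- Every quaternion vector can be rotated by a unitary matrix onto the first coordinate axis. -/
theorem exists_unitary_mulVec_succ_eq_zero {n : ℕ} (v : Fin (n + 1) → Quaternion ℝ) :
    ∃ V ∈ unitary (Matrix (Fin (n + 1)) (Fin (n + 1)) (Quaternion ℝ)),
      ∀ i : Fin n, (V *ᵥ v) i.succ = 0 := by
  obtain ⟨a, r, hn, hr⟩ : ∃ (a : Quaternion ℝ) (r : ℝ),
      Quaternion.normSq a = quaternionNormSq v ∧ star a * v 0 = r := by
    have hq := Real.sq_sqrt (quaternionNormSq_nonneg v)
    by_cases h0 : v 0 = 0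
    · exact ⟨(√(quaternionNormSq v) : ℝ), 0, by rw [Quaternion.normSq_coe, hq], by simp [h0]⟩
    · have hp : Quaternion.normSq (v 0) ≠ 0 := Quaternion.normSq_ne_zero.2 h0
      have hp' := Real.sq_sqrt (Quaternion.normSq_nonneg (a := v 0))
      refine ⟨(√(quaternionNormSq v) / √(Quaternion.normSq (v 0))) • v 0,
        √(quaternionNormSq v) / √(Quaternion.normSq (v 0)) * Quaternion.normSq (v 0), ?_, ?_⟩
      · rw [Quaternion.normSq_smul, div_pow, hq, hp', div_mul_cancel₀ _ hp]
      · rw [Quaternion.star_smul, smul_mul_assoc, Quaternion.star_mul_self, Quaternion.smul_coe]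
  have hr' : star (v 0) * a = r := by simpa using congrArg star hr
  set e : Fin (n + 1) → Quaternion ℝ := Pi.single 0 a with he
  have h1 : star (v - e) ⬝ᵥ v = ((quaternionNormSq v - r : ℝ) : Quaternion ℝ) := by
    rw [star_sub, sub_dotProduct, star_dotProduct_self_quaternion, he, ← Pi.single_star,
      single_dotProduct, hr, Quaternion.coe_sub]
  have h2 : quaternionNormSq (v - e) = 2 * (quaternionNormSq v - r) := by
    have h3 : star (v - e) ⬝ᵥ e = ((r - quaternionNormSq v : ℝ) : Quaternion ℝ) := by
      rw [he, dotProduct_single]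
      simp [sub_mul, hr', Quaternion.star_mul_self, hn]
    have h4 := star_dotProduct_self_quaternion (v - e)
    rw [dotProduct_sub, h1, h3, ← Quaternion.coe_sub] at h4
    linarith [Quaternion.coe_injective h4]
  refine ⟨quaternionHouseholder (v - e), quaternionHouseholder_mem_unitary _, fun i => ?_⟩
  rw [quaternionHouseholder_mulVec _ _ (by rw [h1, h2]; congr 1; ring)]
  simp [he]

/-- The block diagonal matrix with blocks `1` and `A`. -/
def oneBlockDiag {R : Type*} [Zero R] [One R] {n : ℕ} (A : Matrix (Fin n) (Fin n) R) :
    Matrix (Fin (n + 1)) (Fin (n + 1)) R :=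
  Matrix.of (Fin.cons (Fin.cons 1 0) fun i => Fin.cons 0 (A i))

theorem oneBlockDiag_mem_unitary {R : Type*} [Ring R] [StarRing R] {n : ℕ}
    {A : Matrix (Fin n) (Fin n) R} (hA : A ∈ unitary (Matrix (Fin n) (Fin n) R)) :
    oneBlockDiag A ∈ unitary (Matrix (Fin (n + 1)) (Fin (n + 1)) R) := by
  have hmul (B C : Matrix (Fin n) (Fin n) R) :
      oneBlockDiag B * oneBlockDiag C = oneBlockDiag (B * C) := by
    ext i j
    refine Fin.cases ?_ (fun i => ?_) i <;> refine Fin.cases ?_ (fun j => ?_) j <;>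
      simp [oneBlockDiag, Matrix.mul_apply, Fin.sum_univ_succ]
  have hone : oneBlockDiag (1 : Matrix (Fin n) (Fin n) R) = 1 := by
    ext i j
    refine Fin.cases ?_ (fun i => ?_) i <;> refine Fin.cases ?_ (fun j => ?_) j <;>
      simp [oneBlockDiag, Matrix.one_apply, Fin.succ_ne_zero, (Fin.succ_ne_zero _).symm]
  have hstar : star (oneBlockDiag A) = oneBlockDiag (star A) := by
    ext i j
    refine Fin.cases ?_ (fun i => ?_) i <;> refine Fin.cases ?_ (fun j => ?_) j <;>
      simp [oneBlockDiag, Matrix.star_apply]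
  rw [Unitary.mem_iff] at hA ⊢
  rw [hstar, hmul, hmul, hA.1, hA.2, hone]
  exact ⟨rfl, rfl⟩

/-- Every square quaternion matrix becomes upper triangular after left multiplication by a
unitary matrix. -/
theorem exists_unitary_mul_upperTriangular (N : ℕ) (P : Matrix (Fin N) (Fin N) (Quaternion ℝ)) :
    ∃ V ∈ unitary (Matrix (Fin N) (Fin N) (Quaternion ℝ)),
      ∀ i j : Fin N, j < i → (V * P) i j = 0 := by
  induction N with
  | zero => exact ⟨1, one_mem _, fun i => i.elim0⟩
  | succ n ih =>
    obtain ⟨H, hH, hP⟩ := exists_unitary_mulVec_succ_eq_zero (P.col 0)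
    obtain ⟨V, hV, hVP⟩ := ih ((H * P).submatrix Fin.succ Fin.succ)
    replace hP (i : Fin n) : (H * P) i.succ 0 = 0 := hP i
    refine ⟨oneBlockDiag V * H, mul_mem (oneBlockDiag_mem_unitary hV) hH, fun i j => ?_⟩
    rw [mul_assoc]
    generalize H * P = M at hP hVP
    refine Fin.cases (fun h => absurd h (Fin.not_lt_zero j)) (fun i => ?_) i
    refine Fin.cases (fun _ => ?_) (fun j h => ?_) j
    · simp [oneBlockDiag, Matrix.mul_apply, Fin.sum_univ_succ, hP]
    · simpa [oneBlockDiag, Matrix.mul_apply, Fin.sum_univ_succ] using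
        hVP i j (Fin.succ_lt_succ_iff.1 h)

/-- QR decomposition for quaternion matrices: every invertible `N × N` matrix over the
real quaternions factorizes as a unitary quaternion matrix times an upper triangular
quaternion matrix. -/
theorem quaternion_qr_decomposition
    (N : ℕ) (P : Matrix (Fin N) (Fin N) (Quaternion ℝ))
    (hP : ∃ Q : Matrix (Fin N) (Fin N) (Quaternion ℝ), P * Q = 1 ∧ Q * P = 1) :
    ∃ U S : Matrix (Fin N) (Fin N) (Quaternion ℝ),
      U * Uᴴ = 1 ∧ Uᴴ * U = 1 ∧ (∀ i j : Fin N, j < i → S i j = 0) ∧ P = U * S := by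
  obtain ⟨V, hV, hS⟩ := exists_unitary_mul_upperTriangular N P
  rw [Unitary.mem_iff, star_eq_conjTranspose] at hV
  refine ⟨Vᴴ, V * P, ?_, ?_, hS, ?_⟩
  · rw [conjTranspose_conjTranspose, hV.1]
  · rw [conjTranspose_conjTranspose, hV.2]
  · rw [← mul_assoc, hV.1, one_mul]
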